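/- Fix an integer n ≥ 2, a real α with 0 < α < 1, and an integer m ≥ ⌈1/α⌉. Then: (i) for every v ∈ V(α;m) there exists v' ∈ V(α;m+1) with MMS_n(v') = MMS_n(v); and (ii) if moreover m ≥ ⌈2/α⌉ − 1, then for every v ∈ V(α;m+1) there exists v' ∈ V(α;m) with MMS_n(v') = MMS_n(v). Consequently the worst-case MinMaxShare over V(α;m) is weakly increasing in m and is constant for m ≥ ⌈2/α⌉ − 1. -/

import Mathlib

open Finset

/-- A (normalised, additive) disutility function on `m` objects. -/
def IsDisutility (m : ℕ) (v : Fin m → ℝ) : Prop :=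
  (∀ e, 0 ≤ v e) ∧ ∑ e, v e = 1

/-- The MinMaxShare of `v` among `n` agents: the minimum over allocations
`A : Fin m → Fin n` of the maximum bundle disutility. -/
noncomputable def MMS (n m : ℕ) (v : Fin m → ℝ) : ℝ :=
  ⨅ A : Fin m → Fin n, ⨆ j : Fin n, ∑ e ∈ Finset.univ.filter (fun e => A e = j), v e

/-- `v ∈ V(α;m)`: a disutility function on `m` objects whose maximum single-object
value equals `α`. -/
def Vmem (α : ℝ) (m : ℕ) (v : Fin m → ℝ) : Prop :=
  IsDisutility m v ∧ (⨆ e, v e) = α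

theorem vmem_iff {α : ℝ} {m : ℕ} {v : Fin m → ℝ} :
    Vmem α m v ↔ (∀ e, 0 ≤ v e) ∧ ∑ e, v e = 1 ∧ (∀ e, v e ≤ α) ∧ ∃ e, v e = α := by
  have hb : BddAbove (Set.range v) := Set.finite_range v |>.bddAbove
  constructor
  · rintro ⟨⟨h0, h1⟩, h2⟩
    refine ⟨h0, h1, fun e => h2 ▸ le_ciSup hb e, ?_⟩
    rcases isEmpty_or_nonempty (Fin m) with h | h
    · simp at h1
    · obtain ⟨e, he⟩ := exists_eq_ciSup_of_finite (f := v)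
      exact ⟨e, he.trans h2⟩
  · rintro ⟨h0, h1, h2, e, he⟩
    have : Nonempty (Fin m) := ⟨e⟩
    exact ⟨⟨h0, h1⟩, le_antisymm (ciSup_le h2) (he ▸ le_ciSup hb e)⟩

theorem MMS_le_of_allocation {n m : ℕ} (hn : 0 < n) {v : Fin m → ℝ} {T : ℝ} (A : Fin m → Fin n)
    (h : ∀ j, ∑ e ∈ univ.filter (fun e => A e = j), v e ≤ T) : MMS n m v ≤ T := by
  have : Nonempty (Fin n) := ⟨⟨0, hn⟩⟩
  exact (ciInf_le (Set.finite_range _).bddBelow A).trans (ciSup_le h)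

theorem le_MMS {n m : ℕ} (hn : 0 < n) {v : Fin m → ℝ} {T : ℝ}
    (h : ∀ A : Fin m → Fin n, ∃ j, T ≤ ∑ e ∈ univ.filter (fun e => A e = j), v e) :
    T ≤ MMS n m v := by
  have : Nonempty (Fin n) := ⟨⟨0, hn⟩⟩
  refine le_ciInf fun A => ?_
  obtain ⟨j, hj⟩ := h A
  exact hj.trans
    (le_ciSup (f := fun j => ∑ e ∈ univ.filter (fun e => A e = j), v e)
      (Set.finite_range _).bddAbove j)

/-- Merging objects along a map `f` can only increase the MinMaxShare. -/
theorem MMS_le_of_merge {n a b : ℕ} (hn : 0 < n) {v : Fin a → ℝ} {u : Fin b → ℝ}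
    (f : Fin a → Fin b) (h : ∀ x, u x = ∑ e ∈ univ.filter (fun e => f e = x), v e) :
    MMS n a v ≤ MMS n b u := by
  have : Nonempty (Fin n) := ⟨⟨0, hn⟩⟩
  refine le_ciInf fun A => MMS_le_of_allocation hn (A ∘ f) fun j => ?_
  refine le_trans (le_of_eq ?_)
    (le_ciSup (f := fun j => ∑ e ∈ univ.filter (fun e => A e = j), u e)
      (Set.finite_range _).bddAbove j)
  simp only [h, Function.comp_apply]
  rw [← Finset.sum_fiberwise_of_maps_to (s := univ.filter fun e => A (f e) = j)
    (t := univ.filter fun x => A x = j) (g := f) (by simp)]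
  refine Finset.sum_congr rfl fun x hx => ?_
  rw [Finset.filter_filter]
  refine Finset.sum_congr ?_ fun _ _ => rfl
  ext e
  simp only [mem_filter, mem_univ, true_and] at hx ⊢
  grind

theorem MMS_comp_perm {n m : ℕ} (hn : 0 < n) (v : Fin m → ℝ) (σ : Equiv.Perm (Fin m)) :
    MMS n m (v ∘ σ) = MMS n m v := by
  have key : ∀ (v : Fin m → ℝ) (σ : Equiv.Perm (Fin m)), MMS n m (v ∘ σ) ≤ MMS n m v := by
    intro v σ
    refine MMS_le_of_merge hn σ fun x => ?_
    have : univ.filter (fun e => σ e = x) = {σ.symm x} := by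
      ext e
      simp [Equiv.eq_symm_apply]
    simp [this]
  refine le_antisymm (key v σ) ?_
  simpa [Function.comp_assoc] using key (v ∘ σ) σ.symm

theorem sum_filter_insertNth {m : ℕ} (b : Fin (m + 1)) (a x : Fin m) (v : Fin (m + 1) → ℝ) :
    ∑ e ∈ univ.filter (fun e => b.insertNth (α := fun _ => Fin m) a id e = x), v e =
      v (b.succAbove x) + if x = a then v b else 0 := by
  rw [Finset.sum_filter, Fin.sum_univ_succAbove _ b]
  simp [add_comm, eq_comm]

theorem MMS_snoc_zero {n m : ℕ} (hn : 0 < n) (hm : 0 < m) (v : Fin m → ℝ) :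
    MMS n (m + 1) (Fin.snoc (α := fun _ => ℝ) v 0) = MMS n m v := by
  apply le_antisymm
  · refine MMS_le_of_merge hn
      ((Fin.last m).insertNth (α := fun _ => Fin m) ⟨0, hm⟩ id) fun x => ?_
    rw [sum_filter_insertNth]
    simp
  · refine MMS_le_of_merge hn Fin.castSucc fun x => ?_
    rw [Finset.sum_filter]
    refine Fin.lastCases ?_ (fun i => ?_) x
    · simp [Fin.castSucc_ne_last]
    · simp

theorem Vmem.snoc_zero {α : ℝ} (hα : 0 < α) {m : ℕ} {v : Fin m → ℝ} (hv : Vmem α m v) :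
    Vmem α (m + 1) (Fin.snoc (α := fun _ => ℝ) v 0) := by
  rw [vmem_iff] at hv ⊢
  obtain ⟨h0, h1, h2, e, he⟩ := hv
  refine ⟨Fin.lastCases (by simp) (by simpa using h0), ?_,
    Fin.lastCases (by simpa using hα.le) (by simpa using h2), e.castSucc, by simpa using he⟩
  simpa [Fin.sum_univ_castSucc] using h1

theorem Vmem.pos {α : ℝ} {m : ℕ} {v : Fin m → ℝ} (hv : Vmem α m v) : 0 < m := by
  rcases Nat.eq_zero_or_pos m with rfl | h
  · simpa using hv.1.2
  · exact h

theorem exists_vmem_of_le {n k m : ℕ} (hn : 0 < n) {α : ℝ} (hα : 0 < α) (hkm : k ≤ m)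
    {v : Fin k → ℝ} (hv : Vmem α k v) :
    ∃ w : Fin m → ℝ, Vmem α m w ∧ MMS n m w = MMS n k v := by
  induction m, hkm using Nat.le_induction with
  | base => exact ⟨v, hv, rfl⟩
  | succ m _ ih =>
    obtain ⟨w, hw, h⟩ := ih
    exact ⟨_, hw.snoc_zero hα, (MMS_snoc_zero hn hw.pos w).trans h⟩

theorem exists_split {α T : ℝ} (hα : 0 < α) (hT : α < T) {c : ℕ} (hc : T ≤ c * α) :
    ∃ g : Fin c → ℝ, (∀ r, 0 ≤ g r) ∧ ∑ r, g r = T ∧ (∀ r, g r ≤ α) ∧ ∃ r, g r = α := by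
  rcases c with _ | d
  · simp at hc
    linarith
  push_cast at hc
  have hd : (0 : ℝ) < d := by
    by_contra h
    nlinarith
  refine ⟨Fin.cons α fun _ => (T - α) / d, ?_, ?_, ?_, 0, by simp⟩
  · refine Fin.cases (by simpa using hα.le) fun i => ?_
    simpa using div_nonneg (sub_nonneg.2 hT.le) hd.le
  · simp only [Fin.sum_univ_succ, Fin.cons_zero, Fin.cons_succ, sum_const, card_univ,
      Fintype.card_fin, nsmul_eq_mul]
    field_simp
    ring
  · refine Fin.cases (by simp) fun i => ?_
    rw [Fin.cons_succ, div_le_iff₀ hd]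
    linarith

theorem le_MMS_of_vmem {n m : ℕ} (hn : 0 < n) {α : ℝ} {v : Fin m → ℝ}
    (hv : Vmem α m v) : max α (1 / n) ≤ MMS n m v := by
  rw [vmem_iff] at hv
  obtain ⟨h0, h1, -, e, he⟩ := hv
  have : Nonempty (Fin n) := ⟨⟨0, hn⟩⟩
  refine max_le (le_MMS hn fun A => ⟨A e, ?_⟩) (le_MMS hn fun A => ?_)
  · rw [← he]
    exact Finset.single_le_sum (f := v) (fun i _ => h0 i) (by simp)
  · by_contra! h
    have h2 := Finset.sum_lt_sum_of_nonempty (s := univ) univ_nonempty fun j _ => h j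
    rw [Finset.sum_fiberwise, h1] at h2
    have : (n : ℝ) ≠ 0 := by positivity
    simp [this] at h2

theorem MMS_le_one {n m : ℕ} (hn : 0 < n) {v : Fin m → ℝ} (hv : IsDisutility m v) :
    MMS n m v ≤ 1 :=
  MMS_le_of_allocation hn (fun _ => ⟨0, hn⟩) fun _ =>
    hv.2 ▸ Finset.sum_le_sum_of_subset_of_nonneg (filter_subset _ _) fun i _ _ => hv.1 i

theorem exists_vmem_MMS_le {n m : ℕ} (hn : 0 < n) {α : ℝ} (hα : 0 < α) (hα1 : α < 1)
    (h1 : 1 / α ≤ m) (h2 : 2 / α ≤ m + 1) :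
    ∃ w : Fin m → ℝ, Vmem α m w ∧ MMS n m w ≤ max α (1 / n) := by
  have hn' : (0 : ℝ) < n := by exact_mod_cast hn
  rcases le_or_gt (1 / (n : ℝ)) α with h | h
  · obtain ⟨g, g0, gs, gα, gm⟩ := exists_split hα hα1 (c := ⌈1 / α⌉₊)
      ((div_le_iff₀ hα).1 (Nat.le_ceil _))
    have hkn : ⌈1 / α⌉₊ ≤ n := by
      rw [Nat.ceil_le, div_le_iff₀ hα]
      rw [div_le_iff₀ hn'] at h
      linarith
    obtain ⟨w, hw, hwg⟩ := exists_vmem_of_le hn hα (Nat.ceil_le.2 h1)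
      (vmem_iff.2 ⟨g0, gs, gα, gm⟩)
    refine ⟨w, hw, hwg ▸ (MMS_le_of_allocation hn (Fin.castLE hkn) fun j => ?_).trans
      (le_max_left _ _)⟩
    by_cases hj : ∃ i, Fin.castLE hkn i = j
    · obtain ⟨i, rfl⟩ := hj
      simpa [Finset.sum_filter] using gα i
    · push Not at hj
      simpa [hj] using hα.le
  · set c := ⌈1 / (n * α)⌉₊ with hcdef
    have hnα : 0 < n * α := by positivity
    have hc : 1 / (n : ℝ) ≤ c * α := by
      have := (div_le_iff₀ hnα).1 (Nat.le_ceil (1 / (n * α)))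
      rw [div_le_iff₀ hn']
      nlinarith
    obtain ⟨g, g0, gs, gα, r, gr⟩ := exists_split hα h hc
    have hcm : n * c ≤ m := by
      have hc2 := Nat.ceil_lt_add_one (a := 1 / (n * α)) (by positivity)
      have hx : 1 ≤ 1 / (n * α) := by
        rw [lt_div_iff₀ hn'] at h
        rw [le_div_iff₀ hnα]
        linarith
      have h3 : (n * c : ℝ) < n * (2 * (1 / (n * α))) := by
        apply mul_lt_mul_of_pos_left _ hn'
        linarith
      have h4 : (n : ℝ) * (2 * (1 / (n * α))) = 2 / α := by field_simp
      have h5 : ((n * c : ℕ) : ℝ) < (m + 1 : ℕ) := by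
        push_cast
        linarith
      exact Nat.lt_succ_iff.1 (by exact_mod_cast h5)
    let u : Fin (n * c) → ℝ := fun e => g (finProdFinEquiv.symm e).2
    have hu : Vmem α (n * c) u := by
      refine vmem_iff.2 ⟨fun e => g0 _, ?_, fun e => gα _,
        finProdFinEquiv (⟨0, hn⟩, r), by simpa only [u, Equiv.symm_apply_apply] using gr⟩
      rw [← Equiv.sum_comp finProdFinEquiv]
      simp only [u, Equiv.symm_apply_apply, Fintype.sum_prod_type, gs, sum_const, card_univ,
        Fintype.card_fin, nsmul_eq_mul]
      field_simp
    obtain ⟨w, hw, hwu⟩ := exists_vmem_of_le hn hα hcm hu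
    refine ⟨w, hw, hwu ▸ (MMS_le_of_allocation hn (fun e => (finProdFinEquiv.symm e).1)
      fun j => ?_).trans (le_max_right _ _)⟩
    rw [Finset.sum_filter, ← Equiv.sum_comp finProdFinEquiv]
    simp only [u, Equiv.symm_apply_apply, Fintype.sum_prod_type]
    rw [Finset.sum_eq_single j (by intro i _ hi; simp [hi]) (by simp)]
    simp [gs]

theorem exists_pair_add_le {m : ℕ} (hm : 0 < m) {α : ℝ} (hα : 0 < α) (h2 : 2 / α ≤ m + 1)
    {v : Fin (m + 1) → ℝ} (hv : ∑ e, v e = 1) :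
    ∃ (b : Fin (m + 1)) (a : Fin m), v (b.succAbove a) + v b ≤ α := by
  have : Nonempty (Fin m) := ⟨⟨0, hm⟩⟩
  obtain ⟨b, hb⟩ := Finite.exists_min v
  obtain ⟨a, ha⟩ := Finite.exists_min fun i => v (b.succAbove i)
  refine ⟨b, a, ?_⟩
  by_contra! h
  rw [Fin.sum_univ_succAbove _ b] at hv
  have h3 := Finset.card_nsmul_le_sum univ (fun i => v (b.succAbove i)) _ fun i _ => ha i
  simp only [card_univ, Fintype.card_fin, nsmul_eq_mul] at h3
  have h4 := hb (b.succAbove a)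
  rw [div_le_iff₀ hα] at h2
  have h5 : (1 : ℝ) ≤ m := by exact_mod_cast hm
  nlinarith

theorem exists_vmem_le_MMS {n m : ℕ} (hn : 0 < n) (hm : 0 < m) {α : ℝ} (hα : 0 < α)
    (h2 : 2 / α ≤ m + 1) {v : Fin (m + 1) → ℝ} (hv : Vmem α (m + 1) v) :
    ∃ u : Fin m → ℝ, Vmem α m u ∧ MMS n (m + 1) v ≤ MMS n m u := by
  rw [vmem_iff] at hv
  obtain ⟨v0, vs, vα, e, he⟩ := hv
  obtain ⟨b, a, hab⟩ := exists_pair_add_le hm hα h2 vs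
  let u : Fin m → ℝ := fun x => v (b.succAbove x) + if x = a then v b else 0
  have uα : ∀ x, u x ≤ α := by
    intro x
    by_cases hx : x = a
    · simpa [u, hx] using hab
    · simpa [u, hx] using vα _
  refine ⟨u, vmem_iff.2 ⟨?_, ?_, uα, ?_⟩, MMS_le_of_merge hn _ fun x =>
    (sum_filter_insertNth b a x v).symm⟩
  · intro x
    have h1 := v0 (b.succAbove x)
    have h2 := v0 b
    simp only [u]
    split_ifs <;> linarith
  · rw [Fin.sum_univ_succAbove _ b] at vs
    simp only [u, sum_add_distrib, sum_ite_eq', mem_univ, if_true]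
    linarith
  · rcases Fin.eq_self_or_eq_succAbove b e with rfl | ⟨i, rfl⟩
    · refine ⟨a, le_antisymm (uα a) ?_⟩
      simpa [u, he] using v0 _
    · refine ⟨i, le_antisymm (uα i) ?_⟩
      have := v0 b
      simp only [u]
      split_ifs <;> linarith

theorem continuous_MMS {n m : ℕ} (hn : 0 < n) : Continuous (MMS n m) := by
  have : Nonempty (Fin n) := ⟨⟨0, hn⟩⟩
  unfold MMS
  simp only [← Finset.inf'_univ_eq_ciInf, ← Finset.sup'_univ_eq_ciSup]
  refine Continuous.finset_inf'_apply _ fun A _ => Continuous.finset_sup'_apply _ fun j _ => ?_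
  fun_prop

/-- The MinMaxShares attained on `V(α;m)` form an interval. -/
theorem exists_vmem_MMS_eq {n m : ℕ} (hn : 0 < n) {α : ℝ} {u w : Fin m → ℝ}
    (hu : Vmem α m u) (hw : Vmem α m w) {x : ℝ} (hwx : MMS n m w ≤ x) (hxu : x ≤ MMS n m u) :
    ∃ v : Fin m → ℝ, Vmem α m v ∧ MMS n m v = x := by
  rw [vmem_iff] at hu hw
  obtain ⟨u0, us, uα, i, hi⟩ := hu
  obtain ⟨w0, ws, wα, k, hk⟩ := hw
  let σ := Equiv.swap i k
  let p : ℝ → Fin m → ℝ := fun t e => (1 - t) * w (σ e) + t * u e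
  have hp : Continuous fun t => MMS n m (p t) :=
    (continuous_MMS hn).comp (by fun_prop)
  have hp0 : MMS n m (p 0) = MMS n m w := by
    rw [← MMS_comp_perm hn w σ]
    congr 1
    ext e
    simp [p]
  have hp1 : MMS n m (p 1) = MMS n m u := by simp [p]
  obtain ⟨t, ⟨ht0, ht1⟩, ht⟩ := intermediate_value_Icc zero_le_one hp.continuousOn
    (show x ∈ Set.Icc (MMS n m (p 0)) (MMS n m (p 1)) by rw [hp0, hp1]; exact ⟨hwx, hxu⟩)
  refine ⟨p t, vmem_iff.2 ⟨fun e => ?_, ?_, fun e => ?_, i, ?_⟩, ht⟩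
  · exact add_nonneg (mul_nonneg (by linarith) (w0 _)) (mul_nonneg ht0 (u0 _))
  · simp only [p, sum_add_distrib, ← mul_sum, us, Equiv.sum_comp σ w, ws]
    ring
  · have := mul_le_mul_of_nonneg_left (wα (σ e)) (sub_nonneg.2 ht1)
    have := mul_le_mul_of_nonneg_left (uα e) ht0
    simp only [p]
    linarith
  · simp only [p, σ, Equiv.swap_apply_left, hk, hi]
    ring

theorem stmt3 (n : ℕ) (hn : 2 ≤ n) (α : ℝ) (hα0 : 0 < α) (hα1 : α < 1)
    (m : ℕ) (hm : ⌈1/α⌉ ≤ (m : ℤ)) :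
    (∀ v : Fin m → ℝ, Vmem α m v →
      ∃ v' : Fin (m+1) → ℝ, Vmem α (m+1) v' ∧ MMS n (m+1) v' = MMS n m v) ∧
    ((⌈2/α⌉ - 1 ≤ (m : ℤ)) → ∀ v : Fin (m+1) → ℝ, Vmem α (m+1) v →
      ∃ v' : Fin m → ℝ, Vmem α m v' ∧ MMS n m v' = MMS n (m+1) v) ∧
    (sSup {x : ℝ | ∃ v : Fin m → ℝ, Vmem α m v ∧ MMS n m v = x} ≤
      sSup {x : ℝ | ∃ v : Fin (m+1) → ℝ, Vmem α (m+1) v ∧ MMS n (m+1) v = x}) ∧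
    ((⌈2/α⌉ - 1 ≤ (m : ℤ)) →
      sSup {x : ℝ | ∃ v : Fin m → ℝ, Vmem α m v ∧ MMS n m v = x} =
      sSup {x : ℝ | ∃ v : Fin (m+1) → ℝ, Vmem α (m+1) v ∧ MMS n (m+1) v = x}) := by
  have hn0 : 0 < n := by omega
  have h1 : 1 / α ≤ m := by exact_mod_cast Int.ceil_le.1 hm
  have hm0 : 0 < m := by
    have : (0 : ℝ) < m := lt_of_lt_of_le (by positivity) h1
    exact_mod_cast this
  have up : ∀ v : Fin m → ℝ, Vmem α m v →
      ∃ v' : Fin (m+1) → ℝ, Vmem α (m+1) v' ∧ MMS n (m+1) v' = MMS n m v :=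
    fun v hv => exists_vmem_of_le hn0 hα0 (Nat.le_succ m) hv
  have down : (⌈2/α⌉ - 1 ≤ (m : ℤ)) → ∀ v : Fin (m+1) → ℝ, Vmem α (m+1) v →
      ∃ v' : Fin m → ℝ, Vmem α m v' ∧ MMS n m v' = MMS n (m+1) v := by
    intro h v hv
    have h2 : 2 / α ≤ m + 1 := by
      have := Int.ceil_le.1 (sub_le_iff_le_add.1 h)
      exact_mod_cast this
    obtain ⟨w, hw, hwm⟩ := exists_vmem_MMS_le hn0 hα0 hα1 h1 h2
    obtain ⟨u, hu, hum⟩ := exists_vmem_le_MMS hn0 hm0 hα0 h2 hv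
    exact exists_vmem_MMS_eq hn0 hu hw (hwm.trans (le_MMS_of_vmem hn0 hv)) hum
  have hsub : {x : ℝ | ∃ v : Fin m → ℝ, Vmem α m v ∧ MMS n m v = x} ⊆
      {x : ℝ | ∃ v : Fin (m+1) → ℝ, Vmem α (m+1) v ∧ MMS n (m+1) v = x} := by
    rintro x ⟨v, hv, rfl⟩
    exact up v hv
  refine ⟨up, down, ?_, fun h => congrArg sSup (hsub.antisymm ?_)⟩
  · rcases Set.eq_empty_or_nonempty
      {x : ℝ | ∃ v : Fin m → ℝ, Vmem α m v ∧ MMS n m v = x} with he | hne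
    · rw [he, Real.sSup_empty]
      refine Real.sSup_nonneg ?_
      rintro x ⟨v, hv, rfl⟩
      exact hα0.le.trans ((le_max_left _ _).trans (le_MMS_of_vmem hn0 hv))
    · refine csSup_le_csSup ⟨1, ?_⟩ hne hsub
      rintro x ⟨v, hv, rfl⟩
      exact MMS_le_one hn0 hv.1
  · rintro x ⟨v, hv, rfl⟩
    exact down h v hv
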